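/- Suppose 0 < α < minᵢ λᵢ and xᵀU L⁻² Uᵀx > 0. Then for every δ with 0 ≤ δ ≤ α one has f_α(δ) ≤ f_α(0), and for every δ with α < δ < minᵢ λᵢ one has f_α(δ) > f_α(0). -/

import Mathlib

open Matrix

/-- `W(δ) = U · diag(√(λᵢ − δ))`. -/
noncomputable def Wmat {M P : ℕ} (U : Matrix (Fin M) (Fin P) ℝ) (lam : Fin P → ℝ)
    (δ : ℝ) : Matrix (Fin M) (Fin P) ℝ :=
  U * Matrix.diagonal (fun i => Real.sqrt (lam i - δ))

/-- `ẑ(δ) = L⁻¹ · diag(√(λᵢ − δ)) · Uᵀ x`. -/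
noncomputable def zhat {M P : ℕ} (U : Matrix (Fin M) (Fin P) ℝ) (lam : Fin P → ℝ)
    (δ : ℝ) (x : Fin M → ℝ) : Fin P → ℝ :=
  ((Matrix.diagonal lam)⁻¹ * Matrix.diagonal (fun i => Real.sqrt (lam i - δ)) * Uᵀ).mulVec x

/-- Squared Euclidean norm on `ℝ^M`. -/
noncomputable def enormSq {M : ℕ} (v : Fin M → ℝ) : ℝ :=
  ‖(EuclideanSpace.equiv (Fin M) ℝ).symm v‖ ^ 2

/-- `f_α(δ) = (1/2)·(ẑ(δ)ᵀẑ(δ) + (1/α)·‖x − W(δ)ẑ(δ)‖²)`. -/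
noncomputable def fA {M P : ℕ} (U : Matrix (Fin M) (Fin P) ℝ) (lam : Fin P → ℝ)
    (x : Fin M → ℝ) (α δ : ℝ) : ℝ :=
  (1 / 2) * (zhat U lam δ x ⬝ᵥ zhat U lam δ x +
    (1 / α) * enormSq (x - (Wmat U lam δ).mulVec (zhat U lam δ x)))

theorem enormSq_eq_dotProduct {M : ℕ} (v : Fin M → ℝ) : enormSq v = v ⬝ᵥ v := by
  rw [enormSq, EuclideanSpace.norm_sq_eq]
  simp [dotProduct, sq]

theorem inv_diagonal_of_pos {P : ℕ} {lam : Fin P → ℝ} (hlam : ∀ i, 0 < lam i) :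
    (Matrix.diagonal lam)⁻¹ = Matrix.diagonal (fun i => (lam i)⁻¹) := by
  apply Matrix.inv_eq_left_inv
  rw [Matrix.diagonal_mul_diagonal, ← Matrix.diagonal_one]
  congr 1
  ext i
  exact inv_mul_cancel₀ (hlam i).ne'

theorem zhat_apply {M P : ℕ} (U : Matrix (Fin M) (Fin P) ℝ) {lam : Fin P → ℝ}
    (hlam : ∀ i, 0 < lam i) (δ : ℝ) (x : Fin M → ℝ) (i : Fin P) :
    zhat U lam δ x i = (lam i)⁻¹ * (Real.sqrt (lam i - δ) * (Uᵀ *ᵥ x) i) := by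
  rw [zhat, inv_diagonal_of_pos hlam, ← Matrix.mulVec_mulVec, ← Matrix.mulVec_mulVec,
    Matrix.mulVec_diagonal, Matrix.mulVec_diagonal]

theorem Wmat_mulVec_zhat {M P : ℕ} (U : Matrix (Fin M) (Fin P) ℝ) {lam : Fin P → ℝ}
    (hlam : ∀ i, 0 < lam i) {δ : ℝ} (hδ : ∀ i, δ ≤ lam i) (x : Fin M → ℝ) :
    Wmat U lam δ *ᵥ zhat U lam δ x =
      U *ᵥ (fun i => (lam i - δ) * (lam i)⁻¹ * (Uᵀ *ᵥ x) i) := by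
  rw [Wmat, ← Matrix.mulVec_mulVec]
  congr 1
  ext i
  rw [Matrix.mulVec_diagonal, zhat_apply U hlam]
  linear_combination (lam i)⁻¹ * (Uᵀ *ᵥ x) i * Real.mul_self_sqrt (sub_nonneg.2 (hδ i))

theorem enormSq_sub_mulVec {M P : ℕ} {U : Matrix (Fin M) (Fin P) ℝ}
    (hU : Uᵀ * U = (1 : Matrix (Fin P) (Fin P) ℝ)) (x : Fin M → ℝ) (d : Fin P → ℝ) :
    enormSq (x - U *ᵥ d) = x ⬝ᵥ x - 2 * (d ⬝ᵥ (Uᵀ *ᵥ x)) + d ⬝ᵥ d := by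
  have hcross : x ⬝ᵥ (U *ᵥ d) = d ⬝ᵥ (Uᵀ *ᵥ x) := by
    rw [Matrix.dotProduct_mulVec, ← Matrix.mulVec_transpose, dotProduct_comm]
  have hsq : (U *ᵥ d) ⬝ᵥ (U *ᵥ d) = d ⬝ᵥ d := by
    rw [Matrix.dotProduct_mulVec, ← Matrix.mulVec_transpose, Matrix.mulVec_mulVec, hU,
      Matrix.one_mulVec]
  rw [enormSq_eq_dotProduct, sub_dotProduct, dotProduct_sub, dotProduct_sub, hsq,
    dotProduct_comm (U *ᵥ d) x, hcross]
  ring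

theorem dotProduct_inv_sq_mulVec {M P : ℕ} (U : Matrix (Fin M) (Fin P) ℝ) {lam : Fin P → ℝ}
    (hlam : ∀ i, 0 < lam i) (x : Fin M → ℝ) :
    x ⬝ᵥ ((U * (Matrix.diagonal lam)⁻¹ ^ 2 * Uᵀ) *ᵥ x) =
      ∑ i, ((lam i)⁻¹ * (Uᵀ *ᵥ x) i) ^ 2 := by
  rw [inv_diagonal_of_pos hlam, Matrix.diagonal_pow, ← Matrix.mulVec_mulVec,
    ← Matrix.mulVec_mulVec, Matrix.dotProduct_mulVec, ← Matrix.mulVec_transpose]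
  refine Finset.sum_congr rfl fun i _ => ?_
  rw [Matrix.mulVec_diagonal, Pi.pow_apply]
  ring

/-- `f_α` is a quadratic polynomial in `δ`. -/
theorem fA_eq {M P : ℕ} {U : Matrix (Fin M) (Fin P) ℝ}
    (hU : Uᵀ * U = (1 : Matrix (Fin P) (Fin P) ℝ)) {lam : Fin P → ℝ}
    (hlam : ∀ i, 0 < lam i) (x : Fin M → ℝ) (α : ℝ) {δ : ℝ} (hδ : ∀ i, δ ≤ lam i) :
    fA U lam x α δ = (1 / 2) * (∑ i, (lam i)⁻¹ * (Uᵀ *ᵥ x) i ^ 2 +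
        (1 / α) * (x ⬝ᵥ x - ∑ i, (Uᵀ *ᵥ x) i ^ 2)) +
      (1 / 2) * ((1 / α) * δ ^ 2 - δ) *
        x ⬝ᵥ ((U * (Matrix.diagonal lam)⁻¹ ^ 2 * Uᵀ) *ᵥ x) := by
  have hz : zhat U lam δ x ⬝ᵥ zhat U lam δ x =
      ∑ i, (lam i)⁻¹ * (Uᵀ *ᵥ x) i ^ 2 - δ * ∑ i, ((lam i)⁻¹ * (Uᵀ *ᵥ x) i) ^ 2 := by
    rw [Finset.mul_sum, ← Finset.sum_sub_distrib]
    refine Finset.sum_congr rfl fun i _ => ?_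
    rw [zhat_apply U hlam]
    linear_combination ((lam i)⁻¹ * (Uᵀ *ᵥ x) i) ^ 2 *
        Real.mul_self_sqrt (sub_nonneg.2 (hδ i)) +
      (lam i)⁻¹ * (Uᵀ *ᵥ x) i ^ 2 * inv_mul_cancel₀ (hlam i).ne'
  have hr : enormSq (x - Wmat U lam δ *ᵥ zhat U lam δ x) =
      x ⬝ᵥ x - ∑ i, (Uᵀ *ᵥ x) i ^ 2 + δ ^ 2 * ∑ i, ((lam i)⁻¹ * (Uᵀ *ᵥ x) i) ^ 2 := by
    rw [Wmat_mulVec_zhat U hlam hδ, enormSq_sub_mulVec hU, sub_add, sub_add]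
    congr 1
    simp only [dotProduct]
    rw [Finset.mul_sum, Finset.mul_sum, ← Finset.sum_sub_distrib, ← Finset.sum_sub_distrib]
    refine Finset.sum_congr rfl fun i _ => ?_
    have := (hlam i).ne'
    field_simp
    ring
  rw [fA, hz, hr, dotProduct_inv_sq_mulVec U hlam]
  ring

/-- if `xᵀU L⁻² Uᵀx > 0`, then `f_α(δ) ≤ f_α(0)` for `0 ≤ δ ≤ α`
and `f_α(δ) > f_α(0)` for `α < δ < minᵢ λᵢ`. -/
theorem fA_compare_with_zero (M P : ℕ) (hM : 0 < M) (hP : 0 < P)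
    (x : Fin M → ℝ)
    (U : Matrix (Fin M) (Fin P) ℝ)
    (hU : Uᵀ * U = (1 : Matrix (Fin P) (Fin P) ℝ))
    (lam : Fin P → ℝ) (hlam : ∀ i, 0 < lam i)
    (α : ℝ) (hα : 0 < α) (hαlam : ∀ i, α < lam i)
    (hx : 0 < x ⬝ᵥ (U * (Matrix.diagonal lam)⁻¹ ^ 2 * Uᵀ).mulVec x) :
    (∀ δ : ℝ, 0 ≤ δ → δ ≤ α → fA U lam x α δ ≤ fA U lam x α 0) ∧
    (∀ δ : ℝ, α < δ → (∀ i, δ < lam i) → fA U lam x α 0 < fA U lam x α δ) := by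
  have h0 := fA_eq hU hlam x α fun i => (hlam i).le
  refine ⟨fun δ hδ hδα => ?_, fun δ hαδ hδ => ?_⟩
  · rw [h0, fA_eq hU hlam x α fun i => hδα.trans (hαlam i).le]
    have hq : (1 / α) * δ ^ 2 - δ ≤ 0 := by
      rw [show (1 / α) * δ ^ 2 - δ = δ * (δ - α) / α by field_simp]
      exact div_nonpos_of_nonpos_of_nonneg
        (mul_nonpos_of_nonneg_of_nonpos hδ (sub_nonpos.2 hδα)) hα.le
    linarith [mul_nonpos_of_nonpos_of_nonneg hq hx.le]
  · rw [h0, fA_eq hU hlam x α fun i => (hδ i).le]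
    have hq : 0 < (1 / α) * δ ^ 2 - δ := by
      rw [show (1 / α) * δ ^ 2 - δ = δ * (δ - α) / α by field_simp]
      exact div_pos (mul_pos (hα.trans hαδ) (sub_pos.2 hαδ)) hα
    linarith [mul_pos hq hx]
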